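/- arXiv:2507.20725 — 3 statements merged into one kernel-verified Lean document; each statement's English description precedes it below -/
import Mathlib

section
/- Let p ∈ (1,∞), R₂ = 1/√π, b ≤ a real numbers with a > b, and ε > 0 small. Let s_ε ∈ (0, R₂) satisfy the C¹-matching relation (ε/s_ε)^{2/(p−1)} φ′(1) = (a−b)/ln(√π s_ε). Define U_{ε,a,b}(x) := a + (ε/s_ε)^{2/(p−1)} φ(x/s_ε) for 0 ≤ |x| ≤ s_ε, and U_{ε,a,b}(x) := a + (a−b) ln(|x|/s_ε)/ln(√π s_ε) for s_ε ≤ |x| ≤ R₂. Then U_{ε,a,b} ∈ C²(closure of B_{R₂}(0)), it satisfies −Δ U_{ε,a,b} = ε^{−2} [U_{ε,a,b} − a]_+^p in B_{R₂}(0), and U_{ε,a,b} = b on ∂B_{R₂}(0). -/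
open MeasureTheory Metric Set Filter Topology

noncomputable section

/-- The plane `ℝ²`. -/
abbrev R2 : Type := EuclideanSpace ℝ (Fin 2)

/-- The Laplacian of `u : ℝ² → ℝ`. -/
def lap (u : R2 → ℝ) (x : R2) : ℝ :=
  ∑ i : Fin 2, fderiv ℝ (fun y => fderiv ℝ u y (EuclideanSpace.single i 1)) x
      (EuclideanSpace.single i 1)

/-- Positive part `[t]₊ = max (t, 0)`. -/
def pp (t : ℝ) : ℝ := max t 0

lemma fderiv_radial {h : ℝ → ℝ} {d : ℝ} {x : R2} (hx : x ≠ 0)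
    (hd : HasDerivAt h d ‖x‖) (v : R2) :
    fderiv ℝ (fun y : R2 => h ‖y‖) x v = d * (inner ℝ x v / ‖x‖) := by
  have hn : HasFDerivAt (fun y : R2 => ‖y‖) (fderiv ℝ (fun y : R2 => ‖y‖) x) x :=
    ((contDiffAt_norm ℝ hx (n := 1)).differentiableAt (by norm_num)).hasFDerivAt
  have hsq := (hn.mul hn)
  have hsq' := (hasStrictFDerivAt_norm_sq x).hasFDerivAt
  have he : (fun y : R2 => ‖y‖ * ‖y‖) = fun y : R2 => ‖y‖ ^ 2 := by
    funext y; ring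
  have hsq2 : HasFDerivAt (fun y : R2 => ‖y‖ * ‖y‖) _ x := hsq
  rw [he] at hsq2
  have key := congrArg (fun L : R2 →L[ℝ] ℝ => L v) (hsq2.unique hsq')
  have hpos : 0 < ‖x‖ := norm_pos_iff.2 hx
  simp at key
  have h1 : fderiv ℝ (fun y : R2 => ‖y‖) x v = inner ℝ x v / ‖x‖ := by
    rw [eq_div_iff hpos.ne']; linarith
  have h2 := hd.comp_hasFDerivAt x hn
  have h3 : fderiv ℝ (fun y : R2 => h ‖y‖) x = _ := h2.fderiv
  rw [h3]
  simp only [_root_.smul_apply, smul_eq_mul, h1]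

lemma lap_radial {h h1 : ℝ → ℝ} {d : ℝ} {x : R2} (hx : x ≠ 0)
    (hd : ∀ᶠ t in 𝓝 ‖x‖, HasDerivAt h (h1 t) t) (hd2 : HasDerivAt h1 d ‖x‖) :
    lap (fun y : R2 => h ‖y‖) x = d + h1 ‖x‖ / ‖x‖ := by
  have hpos : 0 < ‖x‖ := norm_pos_iff.2 hx
  have hcont : Tendsto (fun y : R2 => ‖y‖) (𝓝 x) (𝓝 ‖x‖) := continuous_norm.tendsto x
  have hq : HasDerivAt (fun t => h1 t / t) ((d * ‖x‖ - h1 ‖x‖ * 1) / ‖x‖ ^ 2) ‖x‖ :=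
    hd2.div (hasDerivAt_id _) hpos.ne'
  have hqn : DifferentiableAt ℝ (fun y : R2 => h1 ‖y‖ / ‖y‖) x :=
    hq.differentiableAt.comp (f := fun y : R2 => ‖y‖) x
      ((contDiffAt_norm ℝ hx (n := 1)).differentiableAt (by norm_num))
  have hterm : ∀ i : Fin 2,
      fderiv ℝ (fun y => fderiv ℝ (fun z : R2 => h ‖z‖) y (EuclideanSpace.single i 1)) x
        (EuclideanSpace.single i 1)
      = h1 ‖x‖ / ‖x‖ + x i * ((d * ‖x‖ - h1 ‖x‖) / ‖x‖ ^ 2 * (x i / ‖x‖)) := by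
    intro i
    have hev : (fun y => fderiv ℝ (fun z : R2 => h ‖z‖) y (EuclideanSpace.single i 1))
        =ᶠ[𝓝 x] fun y : R2 => (h1 ‖y‖ / ‖y‖) * EuclideanSpace.proj (𝕜 := ℝ) i y := by
      filter_upwards [hcont.eventually hd, isOpen_ne.mem_nhds hx] with y hy hy0
      rw [fderiv_radial hy0 hy]
      simp [EuclideanSpace.inner_single_right]
      ring
    rw [hev.fderiv_eq, fderiv_fun_mul hqn (EuclideanSpace.proj (𝕜 := ℝ) i).differentiableAt]
    have := fderiv_radial hx hq (EuclideanSpace.single i 1)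
    simp only [_root_.add_apply, _root_.smul_apply, smul_eq_mul, this,
      ContinuousLinearMap.fderiv]
    simp [EuclideanSpace.inner_single_right]
  have hnorm : ‖x‖ ^ 2 = x 0 ^ 2 + x 1 ^ 2 := by
    rw [EuclideanSpace.norm_sq_eq]; simp
  simp only [lap, hterm, Fin.sum_univ_two]
  field_simp
  linear_combination (-(d * ‖x‖ - h1 ‖x‖)) * hnorm

lemma lap_affine_comp_smul (W : R2 → ℝ) (a k c : ℝ) (x : R2) :
    lap (fun y => a + k * W (c • y)) x = k * c ^ 2 * lap W (c • x) := by
  have h1 : ∀ (F : R2 → ℝ) (m : ℝ) (y v : R2),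
      fderiv ℝ (fun y => m * F (c • y)) y v = m * c * fderiv ℝ F (c • y) v := by
    intro F m y v
    have e : (fun y => m * F (c • y)) = m • (fun y => F (c • y)) := by
      funext y; simp
    rw [e, fderiv_const_smul_field, Pi.smul_apply, fderiv_comp_smul]
    simp [mul_assoc]
  simp only [lap, fderiv_const_add, h1, Finset.mul_sum]
  refine Finset.sum_congr rfl fun i _ => ?_
  rw [h1 (fun z => fderiv ℝ W z (EuclideanSpace.single i 1))]
  ring

lemma lap_congr {u v : R2 → ℝ} {x : R2} (h : u =ᶠ[𝓝 x] v) : lap u x = lap v x := by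
  unfold lap
  refine Finset.sum_congr rfl fun i _ => ?_
  have : (fun y => fderiv ℝ u y (EuclideanSpace.single i 1)) =ᶠ[𝓝 x]
      fun y => fderiv ℝ v y (EuclideanSpace.single i 1) := by
    filter_upwards [h.fderiv (𝕜 := ℝ)] with y hy
    rw [hy]
  rw [this.fderiv_eq]

lemma hasDerivAt_ite_le {f₁ f₂ d₁ d₂ : ℝ → ℝ} {c r : ℝ}
    (h₁ : r ≤ c → HasDerivWithinAt f₁ (d₁ r) (Iic c) r)
    (h₂ : c ≤ r → HasDerivAt f₂ (d₂ r) r)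
    (hf : f₁ c = f₂ c) (hd : d₁ c = d₂ c) :
    HasDerivAt (fun t => if t ≤ c then f₁ t else f₂ t) (if r ≤ c then d₁ r else d₂ r) r := by
  rcases lt_trichotomy r c with h | rfl | h
  · rw [if_pos h.le]
    refine ((h₁ h.le).hasDerivAt (Iic_mem_nhds h)).congr_of_eventuallyEq ?_
    filter_upwards [Iic_mem_nhds h] with t ht
    exact if_pos ht
  · rw [if_pos le_rfl, ← hasDerivWithinAt_univ, ← Iic_union_Ici (a := r)]
    refine HasDerivWithinAt.union ?_ ?_
    · exact (h₁ le_rfl).congr (fun t ht => if_pos ht) (if_pos le_rfl)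
    · rw [hd]
      refine (h₂ le_rfl).hasDerivWithinAt.congr (fun t ht => ?_) (by simp [hf])
      by_cases htr : t ≤ r
      · obtain rfl := le_antisymm htr ht
        simp [hf]
      · simp [htr]
  · rw [if_neg h.not_ge]
    refine (h₂ h.le).congr_of_eventuallyEq ?_
    filter_upwards [Ioi_mem_nhds h] with t ht
    exact if_neg (not_le.2 ht)

lemma contDiffOn_two_of_hasDerivAt {h h₁ h₂ : ℝ → ℝ} {s : Set ℝ} (hs : IsOpen s)
    (hd₁ : ∀ r ∈ s, HasDerivAt h (h₁ r) r) (hd₂ : ∀ r ∈ s, HasDerivAt h₁ (h₂ r) r)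
    (hc : ContinuousOn h₂ s) : ContDiffOn ℝ 2 h s := by
  have e : (2 : WithTop ℕ∞) = 1 + 1 := by norm_num
  rw [e, contDiffOn_succ_iff_deriv_of_isOpen hs]
  refine ⟨fun r hr => (hd₁ r hr).differentiableAt.differentiableWithinAt, by simp, ?_⟩
  have h₁c : ContDiffOn ℝ 1 h₁ s := by
    have e : (1 : WithTop ℕ∞) = 0 + 1 := by norm_num
    rw [e, contDiffOn_succ_iff_deriv_of_isOpen hs]
    refine ⟨fun r hr => (hd₂ r hr).differentiableAt.differentiableWithinAt, by simp, ?_⟩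
    rw [contDiffOn_zero]
    exact hc.congr fun r hr => (hd₂ r hr).deriv
  exact h₁c.congr fun r hr => (hd₁ r hr).deriv

/-- The radial Emden profile on the unit disk, continued by the fundamental solution with
matching slope, is a `C²` solution of `-ΔW = [W]₊ ^ p` on the whole plane. -/
lemma emden_log_extension {p : ℝ} (hp : 1 < p) {φ : R2 → ℝ} {g : ℝ → ℝ} {m : ℝ}
    (hsmooth : ContDiffOn ℝ 2 φ (closedBall 0 1))
    (heq : ∀ x ∈ ball (0:R2) 1, -lap φ x = φ x ^ p)
    (hbdry : ∀ x : R2, ‖x‖ = 1 → φ x = 0)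
    (hpos : ∀ x ∈ ball (0:R2) 1, 0 < φ x)
    (hradial : ∀ x : R2, φ x = g ‖x‖)
    (hg' : HasDerivAt g m 1) (hneg : m < 0)
    {W : R2 → ℝ} (hW : ∀ x, W x = if ‖x‖ ≤ 1 then φ x else m * Real.log ‖x‖) :
    ContDiff ℝ 2 W ∧ ∀ x, -lap W x = pp (W x) ^ p := by
  have hφ : φ = fun y : R2 => g ‖y‖ := funext hradial
  have hp0 : p ≠ 0 := by linarith
  set e : ℝ → R2 := fun r => EuclideanSpace.single 0 r with he
  have hen : ∀ r, ‖e r‖ = |r| := fun r => by simp [he]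
  have hec : ContDiff ℝ 2 e := by
    have : e = fun r => r • EuclideanSpace.single (0 : Fin 2) (1:ℝ) := by
      funext r; ext i; simp [he]
    rw [this]; fun_prop
  set I : Set ℝ := Ioc 0 1 with hI
  have hIu : UniqueDiffOn ℝ I := uniqueDiffOn_Ioc 0 1
  have hgI : ContDiffOn ℝ 2 g I := by
    have h1 : ContDiffOn ℝ 2 (φ ∘ e) I := by
      refine hsmooth.comp hec.contDiffOn fun r hr => ?_
      simp [hen, abs_of_pos hr.1, hr.2]
    refine h1.congr fun r hr => ?_
    simp [hradial, hen, abs_of_pos hr.1]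
  set g₁ := derivWithin g I with hg₁
  set g₂ := derivWithin g₁ I with hg₂
  have hg₁I : ContDiffOn ℝ 1 g₁ I := hgI.derivWithin hIu (by norm_num)
  have hg₂I : ContinuousOn g₂ I := hg₁I.continuousOn_derivWithin hIu (by norm_num)
  have hdg : ∀ r ∈ I, HasDerivWithinAt g (g₁ r) I r := fun r hr =>
    ((hgI.differentiableOn (by norm_num)) r hr).hasDerivWithinAt
  have hdg₁ : ∀ r ∈ I, HasDerivWithinAt g₁ (g₂ r) I r := fun r hr =>
    ((hg₁I.differentiableOn (by norm_num)) r hr).hasDerivWithinAt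
  have h1I : (1 : ℝ) ∈ I := ⟨one_pos, le_rfl⟩
  have hg1 : g 1 = 0 := by
    have := hbdry (e 1) (by simp [hen])
    simpa [hradial, hen] using this
  have hg₁1 : g₁ 1 = m := (hIu 1 h1I).eq_deriv _ (hdg 1 h1I) hg'.hasDerivWithinAt
  have hode : EqOn (fun r => g₂ r + g₁ r / r) (fun r => -(g r ^ p)) I := by
    have hint : EqOn (fun r => g₂ r + g₁ r / r) (fun r => -(g r ^ p)) (Ioo 0 1) := by
      intro r hr
      have hr' : ‖e r‖ = r := by rw [hen, abs_of_pos hr.1]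
      have hnh : ∀ t ∈ Ioo (0:ℝ) 1, I ∈ 𝓝 t := fun t ht => Ioc_mem_nhds ht.1 ht.2
      have h0 : e r ≠ 0 := norm_pos_iff.1 (by rw [hr']; exact hr.1)
      have hl := lap_radial (h := g) (h1 := g₁) (d := g₂ r) h0
        (by
          rw [hr']
          filter_upwards [Ioo_mem_nhds hr.1 hr.2] with t ht
          exact (hdg t ⟨ht.1, ht.2.le⟩).hasDerivAt (hnh t ht))
        (by rw [hr']; exact (hdg₁ r ⟨hr.1, hr.2.le⟩).hasDerivAt (hnh r hr))
      have h2 := heq (e r) (by simp [hr', hr.2])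
      rw [hradial, hφ, hl, hr'] at h2
      simp only
      linarith
    refine hint.of_subset_closure ?_ ?_ Ioo_subset_Ioc_self ?_
    · exact hg₂I.add (hg₁I.continuousOn.div continuousOn_id fun r hr => hr.1.ne')
    · exact (hgI.continuousOn.rpow_const fun r _ => Or.inr (by linarith)).neg
    · rw [closure_Ioo (by norm_num)]; exact Ioc_subset_Icc_self
  have hg₂1 : g₂ 1 = -m := by
    have := hode h1I
    simp [hg1, Real.zero_rpow hp0, hg₁1] at this
    linarith
  have hwithin : ∀ {f : ℝ → ℝ} {d r : ℝ}, 0 < r → HasDerivWithinAt f d I r →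
      HasDerivWithinAt f d (Iic 1) r := by
    intro f d r hr h
    refine h.mono_of_mem_nhdsWithin ?_
    rw [hI, ← Ioi_inter_Iic]
    exact inter_mem (mem_nhdsWithin_of_mem_nhds (Ioi_mem_nhds hr)) self_mem_nhdsWithin
  have hlog : ∀ r : ℝ, 0 < r → HasDerivAt (fun t => m * Real.log t) (m / r) r := fun r hr => by
    simpa [div_eq_mul_inv] using (Real.hasDerivAt_log hr.ne').const_mul m
  have hinv : ∀ r : ℝ, 0 < r → HasDerivAt (fun t => m / t) (-m / r ^ 2) r := fun r hr => by
    simpa [div_eq_mul_inv] using (hasDerivAt_inv hr.ne').const_mul m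
  set G : ℝ → ℝ := fun t => if t ≤ 1 then g t else m * Real.log t with hG
  set G₁ : ℝ → ℝ := fun t => if t ≤ 1 then g₁ t else m / t with hG₁
  set G₂ : ℝ → ℝ := fun t => if t ≤ 1 then g₂ t else -m / t ^ 2 with hG₂
  have hdG : ∀ r ∈ Ioi (0:ℝ), HasDerivAt G (G₁ r) r := fun r hr =>
    hasDerivAt_ite_le (d₁ := g₁) (d₂ := fun t => m / t)
      (fun h => hwithin hr (hdg r ⟨hr, h⟩)) (fun _ => hlog r hr)
      (by simp [hg1]) (by simp [hg₁1])
  have hdG₁ : ∀ r ∈ Ioi (0:ℝ), HasDerivAt G₁ (G₂ r) r := fun r hr =>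
    hasDerivAt_ite_le (d₁ := g₂) (d₂ := fun t => -m / t ^ 2)
      (fun h => hwithin hr (hdg₁ r ⟨hr, h⟩)) (fun _ => hinv r hr)
      (by simp [hg₁1]) (by simp [hg₂1])
  have hcG₂ : ContinuousOn G₂ (Ioi 0) := by
    refine ContinuousOn.if ?_ ?_ ?_
    · rintro r ⟨_, hr⟩
      change r ∈ frontier (Iic 1) at hr
      rw [frontier_Iic, mem_singleton_iff] at hr
      simp [hr, hg₂1]
    · change ContinuousOn g₂ (Ioi 0 ∩ closure (Iic 1))
      rwa [closure_Iic, Ioi_inter_Iic]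
    · refine ContinuousOn.mono (s := Ioi 0) ?_ inter_subset_left
      exact continuousOn_const.div (by fun_prop) fun r hr => pow_ne_zero 2 (ne_of_gt hr)
  have hGC := contDiffOn_two_of_hasDerivAt isOpen_Ioi hdG hdG₁ hcG₂
  have hWG : W = fun y : R2 => G ‖y‖ := by
    funext y; simp only [hW, hG, hradial]
  have hWφ : ∀ x ∈ ball (0:R2) 1, W =ᶠ[𝓝 x] φ := fun x hx => by
    filter_upwards [isOpen_ball.mem_nhds hx] with y hy
    rw [hW, if_pos (mem_ball_zero_iff.1 hy).le]
  refine ⟨contDiff_iff_contDiffAt.2 fun x => ?_, fun x => ?_⟩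
  · by_cases hx : x = 0
    · have hx1 : x ∈ ball (0:R2) 1 := by simp [hx]
      exact (hsmooth.contDiffAt (mem_of_superset (isOpen_ball.mem_nhds hx1)
        ball_subset_closedBall)).congr_of_eventuallyEq (hWφ x hx1)
    · rw [hWG]
      exact (hGC.contDiffAt (Ioi_mem_nhds (norm_pos_iff.2 hx))).comp x (contDiffAt_norm ℝ hx)
  · by_cases hx : ‖x‖ < 1
    · have hx1 : x ∈ ball (0:R2) 1 := by simpa using hx
      rw [lap_congr (hWφ x hx1), heq x hx1, (hWφ x hx1).eq_of_nhds, pp,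
        max_eq_left (hpos x hx1).le]
    · rw [not_lt] at hx
      have hx0 : 0 < ‖x‖ := by linarith
      have hl := lap_radial (norm_pos_iff.1 hx0)
        (by filter_upwards [Ioi_mem_nhds hx0] with t ht using hdG t ht) (hdG₁ _ hx0)
      have hle : W x ≤ 0 := by
        rw [hW]
        split_ifs with h
        · exact (hbdry x (le_antisymm h hx)).le
        · exact mul_nonpos_of_nonpos_of_nonneg hneg.le (Real.log_nonneg hx)
      rw [pp, max_eq_right hle, Real.zero_rpow hp0]
      rw [hWG, hl]
      have h1 : G₁ ‖x‖ = m / ‖x‖ := by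
        rcases hx.eq_or_lt with h | h
        · simp [hG₁, ← h, hg₁1]
        · simp [hG₁, h.not_ge]
      have h2 : G₂ ‖x‖ = -m / ‖x‖ ^ 2 := by
        rcases hx.eq_or_lt with h | h
        · simp [hG₂, ← h, hg₂1]
        · simp [hG₂, h.not_ge]
      rw [h1, h2]
      field_simp
      ring

/-- the Dancer–Yan model profile `U_{ε,a,b}` is a `C²` solution of
`−ΔU = ε⁻² [U − a]₊^p` on the disk of radius `R₂ = 1/√π`, with boundary value `b`.
Here `φ` is the unique positive solution of the Emden problem on the unit disk,
`φ'1 = φ′(1) < 0`, and `s_ε` satisfies the `C¹`-matching relation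
`(ε/s_ε)^{2/(p−1)} φ′(1) = (a−b)/ln(√π s_ε)`. -/
theorem stmt7
    (p : ℝ) (hp : 1 < p)
    (φ : R2 → ℝ) (g : ℝ → ℝ) (φ'1 : ℝ)
    (hsmooth : ContDiffOn ℝ 2 φ (closedBall 0 1))
    (heq : ∀ x ∈ ball (0:R2) 1, -lap φ x = φ x ^ p)
    (hbdry : ∀ x : R2, ‖x‖ = 1 → φ x = 0)
    (hpos : ∀ x ∈ ball (0:R2) 1, 0 < φ x)
    (hradial : ∀ x : R2, φ x = g ‖x‖)
    (hdec : AntitoneOn g (Icc (0:ℝ) 1))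
    (hg' : HasDerivAt g φ'1 1)
    (hneg : φ'1 < 0)
    (a b ε s : ℝ) (hab : b < a) (hε : 0 < ε)
    (hs : 0 < s) (hsR : s < 1 / Real.sqrt Real.pi)
    (hmatch : (ε / s) ^ (2 / (p - 1)) * φ'1 = (a - b) / Real.log (Real.sqrt Real.pi * s))
    (U : R2 → ℝ)
    (hU : ∀ x : R2, U x =
      if ‖x‖ ≤ s then a + (ε / s) ^ (2 / (p - 1)) * φ (s⁻¹ • x)
      else a + (a - b) * Real.log (‖x‖ / s) / Real.log (Real.sqrt Real.pi * s)) :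
    ContDiffOn ℝ 2 U (closedBall 0 (1 / Real.sqrt Real.pi)) ∧
    (∀ x ∈ ball (0:R2) (1 / Real.sqrt Real.pi),
      -lap U x = (1 / ε ^ 2) * pp (U x - a) ^ p) ∧
    (∀ x : R2, ‖x‖ = 1 / Real.sqrt Real.pi → U x = b) := by
  set k := (ε / s) ^ (2 / (p - 1)) with hk
  set R := 1 / Real.sqrt Real.pi with hR
  have hπ : 0 < Real.sqrt Real.pi := Real.sqrt_pos.2 Real.pi_pos
  have hes : 0 < ε / s := div_pos hε hs
  have hk0 : 0 < k := Real.rpow_pos_of_pos hes _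
  have hlogneg : Real.log (Real.sqrt Real.pi * s) < 0 := by
    refine Real.log_neg (mul_pos hπ hs) ?_
    rw [lt_div_iff₀ hπ] at hsR
    linarith
  set W : R2 → ℝ := fun x => if ‖x‖ ≤ 1 then φ x else φ'1 * Real.log ‖x‖ with hW
  obtain ⟨hWC, hWeq⟩ := emden_log_extension hp hsmooth heq hbdry hpos hradial hg' hneg
    (W := W) fun _ => rfl
  have hnorm : ∀ x : R2, ‖s⁻¹ • x‖ = ‖x‖ / s := fun x => by
    rw [norm_smul, norm_inv, Real.norm_of_nonneg hs.le]; ring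
  have hUW : U = fun x => a + k * W (s⁻¹ • x) := by
    funext x
    rw [hU]
    simp only [hW, hnorm, div_le_one hs]
    split_ifs
    · rfl
    · rw [← mul_assoc, hmatch]; ring
  refine ⟨?_, fun x _ => ?_, fun x hx => ?_⟩
  · rw [hUW]
    exact (contDiff_const.add (contDiff_const.mul
      (hWC.comp (contDiff_const_smul s⁻¹)))).contDiffOn
  · have hkp : k ^ p = k * (ε / s) ^ 2 := by
      rw [hk, ← Real.rpow_mul hes.le, ← Real.rpow_natCast, ← Real.rpow_add hes]
      congr 1
      have : p - 1 ≠ 0 := by linarith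
      push_cast
      field_simp
      ring
    have hpp : pp (U x - a) = k * pp (W (s⁻¹ • x)) := by
      simp only [hUW, pp, add_sub_cancel_left, mul_max_of_nonneg _ _ hk0.le, mul_zero]
    have hnn : 0 ≤ pp (W (s⁻¹ • x)) := le_max_right _ _
    rw [hpp, Real.mul_rpow hk0.le hnn, ← hWeq, hkp, hUW, lap_affine_comp_smul]
    field_simp
  · have hlt : ¬ ‖x‖ ≤ s := by rw [hx]; exact hsR.not_ge
    have hlog : Real.log (‖x‖ / s) = -Real.log (Real.sqrt Real.pi * s) := by
      rw [hx, hR, div_div, one_div, Real.log_inv]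
    rw [hU, if_neg hlt, hlog, mul_neg, neg_div, mul_div_cancel_right₀ _ hlogneg.ne]
    ring
end
end

section
/- Let p ∈ (1,∞), R₂ = 1/√π, b ≤ a with a > b, ε > 0 small, s_ε ∈ (0,R₂) defined by (ε/s_ε)^{2/(p−1)} φ′(1) = (a−b)/ln(√π s_ε), and let U_{ε,a,b} be the Dancer–Yan model profile on B_{R₂}(0). Then ∫_{B_{R₂}(0)} ε^{−2} [U_{ε,a,b} − a]_+^{p} dx = (a−b) I_p / (φ′(1) ln(√π s_ε)); in particular s_ε → 0⁺ and this p-mass tends to 0 as ε → 0⁺. -/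
open MeasureTheory Metric Set Filter Topology

noncomputable section

open scoped Pointwise in
/-- Rescaling by `s` identifies the integral of a function of `s⁻¹ • x` over the disk of radius `s`
with `s ^ 2` times the integral over the unit disk. -/
theorem setIntegral_ball_comp_inv_smul (f : R2 → ℝ) {s : ℝ} (hs : 0 < s) :
    ∫ x in ball (0 : R2) s, f (s⁻¹ • x) = s ^ 2 * ∫ x in ball (0 : R2) 1, f x := by
  have h := Measure.setIntegral_comp_smul_of_pos (volume : Measure R2) f (ball (0 : R2) s)
    (inv_pos.2 hs)
  have hball : s⁻¹ • ball (0 : R2) s = ball (0 : R2) 1 := by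
    rw [_root_.smul_ball (inv_pos.2 hs).ne', smul_zero, Real.norm_of_nonneg (inv_pos.2 hs).le,
      inv_mul_cancel₀ hs.ne']
  rw [h, hball]
  simp

/-- The amplitude `k = (ε / s) ^ (2 / (p - 1))` satisfies `ε⁻² k ^ p s ^ 2 = k`. -/
theorem amplitude_identity {p ε s : ℝ} (hp : 1 < p) (hε : 0 < ε) (hs : 0 < s) :
    1 / ε ^ 2 * (((ε / s) ^ (2 / (p - 1))) ^ p * s ^ 2) = (ε / s) ^ (2 / (p - 1)) := by
  have hr : 0 < ε / s := div_pos hε hs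
  have hp' : p - 1 ≠ 0 := (sub_pos.2 hp).ne'
  have hexp : 2 / (p - 1) * p = 2 / (p - 1) + 2 := by field_simp; ring
  rw [← Real.rpow_mul hr.le, hexp, Real.rpow_add hr, Real.rpow_two]
  field_simp

/-- A sequence of radii with `(ε / s) ^ q * (-log (r * s))` bounded below by a positive constant
tends to `0` as `ε → 0`. -/
theorem tendsto_radius_zero {q r c : ℝ} (hq : 0 < q) (hr : 0 < r) (hc : 0 < c) {ε s : ℕ → ℝ}
    (hε : ∀ n, 0 < ε n) (hs : ∀ n, 0 < s n) (hrs : ∀ n, r * s n < 1)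
    (h : ∀ n, c ≤ (ε n / s n) ^ q * -Real.log (r * s n)) (hε0 : Tendsto ε atTop (𝓝 0)) :
    Tendsto s atTop (𝓝 0) := by
  rw [tendsto_order]
  refine ⟨fun y hy => Eventually.of_forall fun n => hy.trans (hs n), fun δ hδ => ?_⟩
  have hlim : Tendsto (fun n => (ε n / δ) ^ q * -Real.log (r * δ)) atTop (𝓝 0) := by
    have h1 : Tendsto (fun n => ε n / δ) atTop (𝓝 0) := by simpa using hε0.div_const δ
    have h2 := h1.rpow_const (p := q) (Or.inr hq.le)
    rw [Real.zero_rpow hq.ne'] at h2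
    simpa using h2.mul_const (-Real.log (r * δ))
  filter_upwards [hlim.eventually_lt_const hc] with n hn
  by_contra! hle
  refine absurd (h n) (not_le.2 (lt_of_le_of_lt ?_ hn))
  have hlog : Real.log (r * δ) ≤ Real.log (r * s n) :=
    Real.log_le_log (mul_pos hr hδ) (mul_le_mul_of_nonneg_left hle hr.le)
  have hlog0 : Real.log (r * s n) < 0 := Real.log_neg (mul_pos hr (hs n)) (hrs n)
  have hdiv : ε n / s n ≤ ε n / δ := div_le_div_of_nonneg_left (hε n).le hδ hle
  exact mul_le_mul (Real.rpow_le_rpow (div_pos (hε n) (hs n)).le hdiv hq.le) (by linarith)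
    (by linarith) (Real.rpow_nonneg (div_pos (hε n) hδ).le q)


/-- for the Dancer–Yan model profiles,
`∫_{B_{R₂}(0)} ε⁻² [U_{ε,a,b} − a]₊^p dx = (a−b) I_p / (φ′(1) ln(√π s_ε))`;
in particular `s_ε → 0⁺` and this `p`-mass tends to `0` as `ε → 0⁺`.
Here `I_p = ∫_{B₁(0)} φ^p` and `R₂ = 1/√π`. -/
theorem stmt9
    (p : ℝ) (hp : 1 < p)
    (φ : R2 → ℝ) (g : ℝ → ℝ) (φ'1 : ℝ)
    (hsmooth : ContDiffOn ℝ 2 φ (closedBall 0 1))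
    (heq : ∀ x ∈ ball (0:R2) 1, -lap φ x = φ x ^ p)
    (hbdry : ∀ x : R2, ‖x‖ = 1 → φ x = 0)
    (hpos : ∀ x ∈ ball (0:R2) 1, 0 < φ x)
    (hradial : ∀ x : R2, φ x = g ‖x‖)
    (hdec : AntitoneOn g (Icc (0:ℝ) 1))
    (hg' : HasDerivAt g φ'1 1)
    (hneg : φ'1 < 0)
    (a b : ℝ) (hab : b < a)
    (ε s : ℕ → ℝ)
    (hε : ∀ n, 0 < ε n)
    (hs : ∀ n, 0 < s n) (hsR : ∀ n, s n < 1 / Real.sqrt Real.pi)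
    (hmatch : ∀ n, (ε n / s n) ^ (2 / (p - 1)) * φ'1 =
      (a - b) / Real.log (Real.sqrt Real.pi * s n))
    (U : ℕ → R2 → ℝ)
    (hU : ∀ n, ∀ x : R2, U n x =
      if ‖x‖ ≤ s n then a + (ε n / s n) ^ (2 / (p - 1)) * φ ((s n)⁻¹ • x)
      else a + (a - b) * Real.log (‖x‖ / s n) / Real.log (Real.sqrt Real.pi * s n))
    (hε0 : Tendsto ε atTop (nhds 0)) :
    (∀ n, (∫ x in ball (0:R2) (1 / Real.sqrt Real.pi), (1 / (ε n) ^ 2) * pp (U n x - a) ^ p) =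
      (a - b) * (∫ x in ball (0:R2) 1, φ x ^ p) /
        (φ'1 * Real.log (Real.sqrt Real.pi * s n))) ∧
    Tendsto s atTop (nhds 0) ∧
    Tendsto (fun n =>
        ∫ x in ball (0:R2) (1 / Real.sqrt Real.pi), (1 / (ε n) ^ 2) * pp (U n x - a) ^ p)
      atTop (nhds 0) := by
  have hsqrt : 0 < Real.sqrt Real.pi := Real.sqrt_pos.2 Real.pi_pos
  have hq : 0 < 2 / (p - 1) := div_pos two_pos (sub_pos.2 hp)
  have hlt1 : ∀ n, Real.sqrt Real.pi * s n < 1 := fun n => by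
    have := (lt_div_iff₀ hsqrt).1 (hsR n)
    linarith
  have hlog : ∀ n, Real.log (Real.sqrt Real.pi * s n) < 0 := fun n =>
    Real.log_neg (mul_pos hsqrt (hs n)) (hlt1 n)
  have hk : ∀ n, 0 < (ε n / s n) ^ (2 / (p - 1)) := fun n =>
    Real.rpow_pos_of_pos (div_pos (hε n) (hs n)) _
  have hmass : ∀ n, (∫ x in ball (0:R2) (1 / Real.sqrt Real.pi),
      (1 / (ε n) ^ 2) * pp (U n x - a) ^ p) =
      (a - b) * (∫ x in ball (0:R2) 1, φ x ^ p) /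
        (φ'1 * Real.log (Real.sqrt Real.pi * s n)) := by
    intro n
    have hp0 : p ≠ 0 := by linarith
    have hout : ∀ x ∈ ball (0:R2) (1 / Real.sqrt Real.pi) \ ball 0 (s n),
        (1 / (ε n) ^ 2) * pp (U n x - a) ^ p = 0 := by
      rintro x ⟨-, hx⟩
      have hx' : s n ≤ ‖x‖ := by simpa using hx
      have hpp : pp (U n x - a) = 0 := by
        rw [hU]
        split_ifs with hle
        · have h1 : ‖(s n)⁻¹ • x‖ = 1 := by
            rw [norm_smul, Real.norm_of_nonneg (inv_pos.2 (hs n)).le, le_antisymm hle hx',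
              inv_mul_cancel₀ (hs n).ne']
          simp [hbdry _ h1, pp]
        · have h1 : 0 ≤ Real.log (‖x‖ / s n) := Real.log_nonneg ((one_le_div (hs n)).2 hx')
          have h2 := div_nonpos_of_nonneg_of_nonpos
            (mul_nonneg (sub_pos.2 hab).le h1) (hlog n).le
          exact max_eq_right (by linarith)
      rw [hpp, Real.zero_rpow hp0, mul_zero]
    have hin : ∀ x ∈ ball (0:R2) (s n), (1 / (ε n) ^ 2) * pp (U n x - a) ^ p =
        (1 / (ε n) ^ 2) * ((ε n / s n) ^ (2 / (p - 1))) ^ p * φ ((s n)⁻¹ • x) ^ p := by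
      intro x hx
      have hx' : ‖x‖ < s n := by simpa using hx
      have hmem : (s n)⁻¹ • x ∈ ball (0:R2) 1 := by
        rw [mem_ball_zero_iff, norm_smul, Real.norm_of_nonneg (inv_pos.2 (hs n)).le,
          inv_mul_lt_one₀ (hs n)]
        exact hx'
      have hφ := (hpos _ hmem).le
      have hpp : pp (U n x - a) = (ε n / s n) ^ (2 / (p - 1)) * φ ((s n)⁻¹ • x) := by
        rw [hU, if_pos hx'.le, add_sub_cancel_left]
        exact max_eq_left (mul_nonneg (hk n).le hφ)
      rw [hpp, Real.mul_rpow (hk n).le hφ, mul_assoc]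
    rw [setIntegral_eq_of_subset_of_forall_sdiff_eq_zero measurableSet_ball
      (ball_subset_ball (hsR n).le) hout, setIntegral_congr_fun measurableSet_ball hin,
      integral_const_mul, setIntegral_ball_comp_inv_smul (fun x => φ x ^ p) (hs n)]
    have hamp := amplitude_identity hp (hε n) (hs n)
    have hkeq : (ε n / s n) ^ (2 / (p - 1)) =
        (a - b) / (φ'1 * Real.log (Real.sqrt Real.pi * s n)) := by
      rw [mul_comm φ'1, ← div_div, ← hmatch n, mul_div_cancel_right₀ _ hneg.ne]
    rw [mul_div_right_comm, ← hkeq, ← mul_assoc]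
    congr 1
    rw [mul_assoc]
    exact hamp
  have hs0 : Tendsto s atTop (𝓝 0) := by
    refine tendsto_radius_zero hq hsqrt (div_pos (sub_pos.2 hab) (neg_pos.2 hneg)) hε hs hlt1
      (fun n => le_of_eq ?_) hε0
    have h := (eq_div_iff (hlog n).ne).1 (hmatch n)
    rw [div_eq_iff (neg_pos.2 hneg).ne']
    linarith
  refine ⟨hmass, hs0, ?_⟩
  simp_rw [hmass]
  have harg : Tendsto (fun n => Real.sqrt Real.pi * s n) atTop (𝓝[>] 0) :=
    tendsto_nhdsWithin_iff.2 ⟨by simpa using hs0.const_mul (Real.sqrt Real.pi),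
      Eventually.of_forall fun n => mul_pos hsqrt (hs n)⟩
  have hden : Tendsto (fun n => φ'1 * Real.log (Real.sqrt Real.pi * s n)) atTop atTop :=
    (Real.tendsto_log_nhdsGT_zero.comp harg).const_mul_atBot_of_neg hneg
  exact hden.const_div_atTop _
end
end

section
/- Let p ∈ (1,∞) and a > 0. Then there is a function u ∈ C²(ℝ) with u(0) = a, u′(0) = 0, u even, solving −u″ = [u]_+^p on ℝ, such that: u > 0 exactly on (−t₀, t₀) where t₀ = √((p+1)/2) · ∫₀^a ds/√(a^{p+1} − s^{p+1}) is finite; and u(t) = −√(2/(p+1)) a^{(p+1)/2} (|t| − t₀) for |t| ≥ t₀. Consequently, the function w^{(1D)}(x¹,x²) := u(x¹) is a classical solution of −Δw = [w]_+^p in ℝ² whose masses ∫_{ℝ²} [w^{(1D)}]_+^{p+k} dx are infinite for k = −1, 0, 1; in particular the entire planar equation admits solutions of infinite p-mass with unbounded plasma region {w > 0}. -/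
open MeasureTheory Metric Set Filter Topology

noncomputable section

lemma pp_nonneg (t : ℝ) : 0 ≤ pp t := le_max_right _ _

lemma pp_of_nonneg {t : ℝ} (ht : 0 ≤ t) : pp t = t := max_eq_left ht

lemma pp_of_nonpos {t : ℝ} (ht : t ≤ 0) : pp t = 0 := max_eq_right ht

lemma continuous_pp : Continuous pp := continuous_id.max continuous_const

lemma continuous_pp_rpow {q : ℝ} (hq : 0 < q) : Continuous fun t => pp t ^ q :=
  continuous_pp.rpow_const fun _ => Or.inr hq.le

lemma hasDerivAt_pp_rpow {p : ℝ} (hp : 0 < p) (t : ℝ) :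
    HasDerivAt (fun s => pp s ^ (p + 1)) ((p + 1) * pp t ^ p) t := by
  have away : ∀ y : ℝ, y ≠ 0 → HasDerivAt (fun s => pp s ^ (p + 1)) ((p + 1) * pp y ^ p) y := by
    intro y hy
    rcases lt_or_gt_of_ne hy with h | h
    · have h0 : (fun s => pp s ^ (p + 1)) =ᶠ[𝓝 y] fun _ => 0 := by
        filter_upwards [Iio_mem_nhds h] with s hs
        rw [pp_of_nonpos (le_of_lt hs), Real.zero_rpow (by positivity)]
      rw [pp_of_nonpos h.le, Real.zero_rpow hp.ne', mul_zero]
      exact (hasDerivAt_const y (0 : ℝ)).congr_of_eventuallyEq h0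
    · have h0 : (fun s => pp s ^ (p + 1)) =ᶠ[𝓝 y] fun s => s ^ (p + 1) := by
        filter_upwards [Ioi_mem_nhds h] with s hs
        rw [pp_of_nonneg (le_of_lt hs)]
      rw [pp_of_nonneg h.le]
      have h1 := Real.hasDerivAt_rpow_const (x := y) (p := p + 1) (Or.inl hy)
      rw [add_sub_cancel_right] at h1
      exact h1.congr_of_eventuallyEq h0
  by_cases ht : t = 0
  · subst ht
    exact hasDerivAt_of_hasDerivAt_of_ne away
      (continuous_pp_rpow (by positivity)).continuousAt
      (continuous_const.mul (continuous_pp_rpow hp)).continuousAt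
  · exact away t ht

/-- The energy defect `a^(p+1) - [s]₊^(p+1)`. -/
def energyGap (p a s : ℝ) : ℝ := a ^ (p + 1) - pp s ^ (p + 1)

/-- The time per unit of height spent by the one-dimensional solution of amplitude `a` at height
`s < a`, extended by `1` above `a`. -/
def slowness (p a s : ℝ) : ℝ :=
  if s < a then Real.sqrt ((p + 1) / 2) / Real.sqrt (energyGap p a s) else 1

/-- The (nonpositive) time at which the one-dimensional solution reaches the height `s ≤ a`. -/
def signedTime (p a s : ℝ) : ℝ := ∫ r in a..s, slowness p a r

section

variable {p a : ℝ}

lemma continuous_energyGap (hp : 1 < p) : Continuous (energyGap p a) :=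
  continuous_const.sub (continuous_pp_rpow (by linarith))

lemma energyGap_self (ha : 0 < a) : energyGap p a a = 0 := by
  simp [energyGap, pp_of_nonneg ha.le]

lemma energyGap_pos (hp : 1 < p) (ha : 0 < a) {s : ℝ} (hs : s < a) : 0 < energyGap p a s :=
  sub_pos.2 <| Real.rpow_lt_rpow (pp_nonneg s) (max_lt hs ha) (by linarith)

lemma energyGap_le (s : ℝ) : energyGap p a s ≤ a ^ (p + 1) :=
  sub_le_self _ (Real.rpow_nonneg (pp_nonneg s) _)

lemma energyGap_of_nonpos (hp : 1 < p) {s : ℝ} (hs : s ≤ 0) : energyGap p a s = a ^ (p + 1) := by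
  rw [energyGap, pp_of_nonpos hs, Real.zero_rpow (by linarith), sub_zero]

lemma mul_sub_le_energyGap (hp : 1 < p) (ha : 0 < a) {s : ℝ} (hs : 0 ≤ s) (hsa : s ≤ a) :
    a ^ p * (a - s) ≤ energyGap p a s := by
  have h1 : s ^ p ≤ a ^ p := Real.rpow_le_rpow hs hsa (by linarith)
  rw [energyGap, pp_of_nonneg hs, Real.rpow_add_one ha.ne',
    Real.rpow_add_one' hs (by linarith)]
  nlinarith [mul_le_mul_of_nonneg_right h1 hs]

lemma hasDerivAt_energyGap (hp : 1 < p) (s : ℝ) :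
    HasDerivAt (energyGap p a) (-((p + 1) * pp s ^ p)) s :=
  (hasDerivAt_pp_rpow (by linarith) s).const_sub _

lemma measurable_slowness (hp : 1 < p) : Measurable (slowness p a) :=
  Measurable.ite measurableSet_Iio
    (measurable_const.div (continuous_energyGap hp).measurable.sqrt) measurable_const

lemma continuousAt_slowness (hp : 1 < p) (ha : 0 < a) {s : ℝ} (hs : s < a) :
    ContinuousAt (slowness p a) s := by
  have h : slowness p a =ᶠ[𝓝 s]
      fun r => Real.sqrt ((p + 1) / 2) / Real.sqrt (energyGap p a r) := by
    filter_upwards [Iio_mem_nhds hs] with r hr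
    exact if_pos hr
  exact (continuousAt_const.div (continuous_energyGap hp).continuousAt.sqrt
    (Real.sqrt_pos.2 (energyGap_pos hp ha hs)).ne').congr h.symm

lemma intervalIntegrable_inv_sqrt_energyGap (hp : 1 < p) (ha : 0 < a) :
    IntervalIntegrable (fun s => 1 / Real.sqrt (energyGap p a s)) volume 0 a := by
  have h1 : IntervalIntegrable (fun s : ℝ => (Real.sqrt (a ^ p))⁻¹ * (a - s) ^ (-(1 / 2) : ℝ))
      volume 0 a := by
    have h := (intervalIntegral.intervalIntegrable_rpow' (a := a) (b := 0)
      (r := -(1 / 2)) (by norm_num)).comp_sub_left a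
    simp only [sub_self, sub_zero] at h
    exact h.const_mul _
  refine h1.mono_fun
    (measurable_const.div (continuous_energyGap hp).measurable.sqrt).aestronglyMeasurable ?_
  refine (ae_restrict_iff' measurableSet_uIoc).2 (Eventually.of_forall fun s hs => ?_)
  rw [uIoc_of_le ha.le] at hs
  rcases hs.2.eq_or_lt with rfl | hsa
  · simp [energyGap_self ha]
  have hpos : 0 < a ^ p * (a - s) := mul_pos (Real.rpow_pos_of_pos ha p) (sub_pos.2 hsa)
  have h2 : (Real.sqrt (a ^ p))⁻¹ * (a - s) ^ (-(1 / 2) : ℝ) =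
      1 / Real.sqrt (a ^ p * (a - s)) := by
    rw [Real.sqrt_mul (Real.rpow_pos_of_pos ha p).le, Real.rpow_neg (sub_pos.2 hsa).le,
      ← Real.sqrt_eq_rpow, one_div, mul_inv]
  dsimp only
  rw [h2, Real.norm_of_nonneg (by positivity), Real.norm_of_nonneg (by positivity)]
  exact one_div_le_one_div_of_le (Real.sqrt_pos.2 hpos)
    (Real.sqrt_le_sqrt (mul_sub_le_energyGap hp ha hs.1.le hsa.le))

lemma intervalIntegrable_slowness (hp : 1 < p) (ha : 0 < a) (x y : ℝ) :
    IntervalIntegrable (slowness p a) volume x y := by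
  have below : ∀ z, IntervalIntegrable (slowness p a) volume 0 z := by
    have h0a : IntervalIntegrable (slowness p a) volume 0 a := by
      refine ((intervalIntegrable_inv_sqrt_energyGap hp ha).const_mul
        (Real.sqrt ((p + 1) / 2))).congr_uIoo fun s hs => ?_
      rw [uIoo_of_le ha.le] at hs
      simp only [slowness, if_pos hs.2, mul_one_div]
    intro z
    rcases le_or_gt a z with hz | hz
    · refine h0a.trans ((intervalIntegrable_const (c := (1 : ℝ))).congr_uIoo fun s hs => ?_)
      rw [uIoo_of_le hz] at hs
      exact (if_neg hs.1.not_gt).symm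
    · refine ContinuousOn.intervalIntegrable fun s hs =>
        (continuousAt_slowness hp ha (lt_of_le_of_lt hs.2 (max_lt ha hz))).continuousWithinAt
  exact (below x).symm.trans (below y)

lemma le_slowness (hp : 1 < p) (ha : 0 < a) (s : ℝ) :
    min (Real.sqrt ((p + 1) / 2) / Real.sqrt (a ^ (p + 1))) 1 ≤ slowness p a s := by
  rw [slowness]
  split_ifs with h
  · exact (min_le_left _ _).trans (div_le_div_of_nonneg_left (Real.sqrt_nonneg _)
      (Real.sqrt_pos.2 (energyGap_pos hp ha h)) (Real.sqrt_le_sqrt (energyGap_le s)))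
  · exact min_le_right _ _

lemma signedTime_self : signedTime p a a = 0 := intervalIntegral.integral_same

lemma continuous_signedTime (hp : 1 < p) (ha : 0 < a) : Continuous (signedTime p a) :=
  intervalIntegral.continuous_primitive (intervalIntegrable_slowness hp ha) a

lemma exists_mul_sub_le_signedTime_sub (hp : 1 < p) (ha : 0 < a) :
    ∃ m : ℝ, 0 < m ∧ ∀ x y, x ≤ y → m * (y - x) ≤ signedTime p a y - signedTime p a x := by
  refine ⟨min (Real.sqrt ((p + 1) / 2) / Real.sqrt (a ^ (p + 1))) 1,
    lt_min (by positivity) one_pos, fun x y hxy => ?_⟩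
  have hi := intervalIntegrable_slowness hp ha
  rw [signedTime, signedTime, intervalIntegral.integral_interval_sub_left (hi _ _) (hi _ _)]
  have h := intervalIntegral.integral_mono_on hxy intervalIntegrable_const (hi x y)
    fun s _ => le_slowness hp ha s
  rwa [intervalIntegral.integral_const, smul_eq_mul, mul_comm] at h

lemma strictMono_signedTime (hp : 1 < p) (ha : 0 < a) : StrictMono (signedTime p a) := by
  obtain ⟨m, hm, h⟩ := exists_mul_sub_le_signedTime_sub hp ha
  intro x y hxy
  have := h x y hxy.le
  nlinarith [mul_pos hm (sub_pos.2 hxy)]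

lemma surjective_signedTime (hp : 1 < p) (ha : 0 < a) :
    Function.Surjective (signedTime p a) := by
  obtain ⟨m, hm, h⟩ := exists_mul_sub_le_signedTime_sub hp ha
  refine (continuous_signedTime hp ha).surjective ?_ ?_
  · refine tendsto_atTop_mono' _ ?_
      ((tendsto_atTop_add_const_right _ (-a) tendsto_id).const_mul_atTop hm)
    filter_upwards [eventually_ge_atTop a] with y hy
    have := h a y hy
    rw [signedTime_self] at this
    simpa [sub_eq_add_neg] using this
  · refine tendsto_atBot_mono' _ ?_
      ((tendsto_atBot_add_const_right _ (-a) tendsto_id).const_mul_atBot hm)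
    filter_upwards [eventually_le_atBot a] with y hy
    have := h y a hy
    rw [signedTime_self] at this
    simp only [id]
    linarith

lemma hasDerivAt_signedTime (hp : 1 < p) (ha : 0 < a) {s : ℝ} (hs : s < a) :
    HasDerivAt (signedTime p a) (slowness p a s) s :=
  intervalIntegral.integral_hasDerivAt_right (intervalIntegrable_slowness hp ha a s)
    (measurable_slowness hp).stronglyMeasurable.stronglyMeasurableAtFilter
    (continuousAt_slowness hp ha hs)

lemma signedTime_zero (ha : 0 < a) :
    signedTime p a 0 = -(Real.sqrt ((p + 1) / 2) *
      ∫ s in (0:ℝ)..a, 1 / Real.sqrt (a ^ (p + 1) - s ^ (p + 1))) := by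
  rw [signedTime, intervalIntegral.integral_symm, ← intervalIntegral.integral_const_mul]
  congr 1
  refine intervalIntegral.integral_congr_Ioo_of_le ha.le fun s hs => ?_
  simp only [slowness, if_pos hs.2, mul_one_div, energyGap, pp_of_nonneg hs.1.le]

lemma signedTime_of_nonpos (hp : 1 < p) (ha : 0 < a) {s : ℝ} (hs : s ≤ 0) :
    signedTime p a s =
      signedTime p a 0 + s * (Real.sqrt ((p + 1) / 2) / Real.sqrt (a ^ (p + 1))) := by
  have hi := intervalIntegrable_slowness hp ha
  have h : ∫ r in (0:ℝ)..s, slowness p a r =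
      ∫ _ in (0:ℝ)..s, Real.sqrt ((p + 1) / 2) / Real.sqrt (a ^ (p + 1)) := by
    refine intervalIntegral.integral_congr fun r hr => ?_
    rw [uIcc_of_ge hs] at hr
    simp only [slowness, if_pos (hr.2.trans_lt ha), energyGap_of_nonpos hp hr.2]
  rw [intervalIntegral.integral_const, smul_eq_mul, sub_zero] at h
  rw [← h, signedTime, signedTime, intervalIntegral.integral_add_adjacent_intervals (hi _ _)
    (hi _ _)]

/-- `signedTime` as an order isomorphism of the line. -/
def signedTimeIso (hp : 1 < p) (ha : 0 < a) : ℝ ≃o ℝ :=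
  (strictMono_signedTime hp ha).orderIsoOfSurjective _ (surjective_signedTime hp ha)

/-- The one-dimensional solution of amplitude `a`. -/
def profile (hp : 1 < p) (ha : 0 < a) (t : ℝ) : ℝ := (signedTimeIso hp ha).symm (-|t|)

/-- The velocity of `profile`. -/
def velocity (hp : 1 < p) (ha : 0 < a) (t : ℝ) : ℝ :=
  -SignType.sign t * (Real.sqrt (energyGap p a (profile hp ha t)) / Real.sqrt ((p + 1) / 2))

variable (hp : 1 < p) (ha : 0 < a)

lemma profile_eq_iff {t s : ℝ} : profile hp ha t = s ↔ -|t| = signedTime p a s :=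
  (signedTimeIso hp ha).symm_apply_eq

lemma lt_profile_iff {t s : ℝ} : s < profile hp ha t ↔ signedTime p a s < -|t| :=
  (signedTimeIso hp ha).lt_symm_apply

lemma profile_lt_iff {t s : ℝ} : profile hp ha t < s ↔ -|t| < signedTime p a s :=
  (signedTimeIso hp ha).symm_apply_lt

lemma profile_zero : profile hp ha 0 = a := by
  rw [profile_eq_iff, signedTime_self, abs_zero, neg_zero]

lemma profile_lt {t : ℝ} (ht : t ≠ 0) : profile hp ha t < a := by
  rw [profile_lt_iff, signedTime_self, neg_lt_zero]
  exact abs_pos.2 ht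

lemma continuous_profile : Continuous (profile hp ha) :=
  (signedTimeIso hp ha).symm.continuous.comp continuous_abs.neg

lemma velocity_zero : velocity hp ha 0 = 0 := by simp [velocity]

lemma continuousAt_velocity_zero : ContinuousAt (velocity hp ha) 0 := by
  have h : Tendsto (fun t => Real.sqrt (energyGap p a (profile hp ha t)) / Real.sqrt ((p + 1) / 2))
      (𝓝 0) (𝓝 0) := by
    have hc : Continuous fun t =>
        Real.sqrt (energyGap p a (profile hp ha t)) / Real.sqrt ((p + 1) / 2) :=
      (((continuous_energyGap hp).comp (continuous_profile hp ha)).sqrt).div_const _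
    simpa [profile_zero, energyGap_self ha] using hc.tendsto 0
  rw [ContinuousAt, velocity_zero]
  refine squeeze_zero_norm (fun t => ?_) h
  rw [velocity, norm_mul, Real.norm_of_nonneg (by positivity : 0 ≤ Real.sqrt
    (energyGap p a (profile hp ha t)) / Real.sqrt ((p + 1) / 2))]
  refine mul_le_of_le_one_left (by positivity) ?_
  rcases lt_trichotomy t 0 with ht | rfl | ht
  · simp [sign_neg ht]
  · simp
  · simp [sign_pos ht]

lemma hasDerivAt_profile_of_ne {t : ℝ} (ht : t ≠ 0) :
    HasDerivAt (profile hp ha) (velocity hp ha t) t := by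
  have hlt := profile_lt hp ha ht
  have hgap := Real.sqrt_pos.2 (energyGap_pos hp ha hlt)
  have hs : slowness p a (profile hp ha t) =
      Real.sqrt ((p + 1) / 2) / Real.sqrt (energyGap p a (profile hp ha t)) := if_pos hlt
  have hinv : HasDerivAt (signedTimeIso hp ha).symm (slowness p a (profile hp ha t))⁻¹ (-|t|) :=
    HasDerivAt.of_local_left_inverse (signedTimeIso hp ha).symm.continuous.continuousAt
      (hasDerivAt_signedTime hp ha hlt) (by rw [hs]; positivity)
      (Eventually.of_forall fun y => (signedTimeIso hp ha).apply_symm_apply y)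
  refine (hinv.comp t (hasDerivAt_abs ht).neg).congr_deriv ?_
  rw [velocity, hs, inv_div, mul_comm]

lemma hasDerivAt_profile (t : ℝ) : HasDerivAt (profile hp ha) (velocity hp ha t) t := by
  by_cases ht : t = 0
  · subst ht
    exact hasDerivAt_of_hasDerivAt_of_ne (fun _ => hasDerivAt_profile_of_ne hp ha)
      (continuous_profile hp ha).continuousAt (continuousAt_velocity_zero hp ha)
  · exact hasDerivAt_profile_of_ne hp ha ht

lemma hasDerivAt_velocity_of_ne {t : ℝ} (ht : t ≠ 0) :
    HasDerivAt (velocity hp ha) (-pp (profile hp ha t) ^ p) t := by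
  have hgap := energyGap_pos hp ha (profile_lt hp ha ht)
  have hsqrt := Real.sqrt_pos.2 hgap
  have hK : 0 < (p + 1) / 2 := by linarith
  have hK' := Real.sqrt_pos.2 hK
  have hsign : (SignType.sign t : ℝ) * SignType.sign t = 1 := by
    rcases lt_or_gt_of_ne ht with h | h <;> simp [sign_neg, sign_pos, h]
  have hloc : velocity hp ha =ᶠ[𝓝 t] fun s => -SignType.sign t *
      (Real.sqrt (energyGap p a (profile hp ha s)) / Real.sqrt ((p + 1) / 2)) := by
    have : ∀ᶠ s in 𝓝 t, SignType.sign s = SignType.sign t := by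
      rcases lt_or_gt_of_ne ht with h | h
      · filter_upwards [Iio_mem_nhds h] with s hs
        rw [sign_neg h, sign_neg hs]
      · filter_upwards [Ioi_mem_nhds h] with s hs
        rw [sign_pos h, sign_pos hs]
    filter_upwards [this] with s hs
    rw [velocity, hs]
  have hd := ((((hasDerivAt_energyGap (a := a) hp (profile hp ha t)).comp t
    (hasDerivAt_profile_of_ne hp ha ht)).sqrt hgap.ne').div_const
      (Real.sqrt ((p + 1) / 2))).const_mul (-(SignType.sign t : ℝ))
  refine (hd.congr_of_eventuallyEq hloc).congr_deriv ?_
  simp only [Function.comp_apply, velocity]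
  have hsq := Real.mul_self_sqrt hK.le
  set σ : ℝ := (SignType.sign t : ℝ)
  set k := Real.sqrt ((p + 1) / 2)
  set g := Real.sqrt (energyGap p a (profile hp ha t))
  have hp1 : p + 1 = 2 * (k * k) := by rw [hsq]; ring
  rw [hp1]
  field_simp
  linear_combination -(pp (profile hp ha t) ^ p) * hsign

lemma continuous_pp_profile_rpow {q : ℝ} (hq : 0 < q) :
    Continuous fun t => pp (profile hp ha t) ^ q :=
  (continuous_pp_rpow hq).comp (continuous_profile hp ha)

lemma hasDerivAt_velocity (t : ℝ) :
    HasDerivAt (velocity hp ha) (-pp (profile hp ha t) ^ p) t := by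
  by_cases ht : t = 0
  · subst ht
    exact hasDerivAt_of_hasDerivAt_of_ne (g := fun t => -pp (profile hp ha t) ^ p)
      (fun _ => hasDerivAt_velocity_of_ne hp ha) (continuousAt_velocity_zero hp ha)
      (continuous_pp_profile_rpow hp ha (by linarith)).neg.continuousAt
  · exact hasDerivAt_velocity_of_ne hp ha ht

lemma deriv_profile : deriv (profile hp ha) = velocity hp ha :=
  funext fun t => (hasDerivAt_profile hp ha t).deriv

lemma deriv_velocity : deriv (velocity hp ha) = fun t => -pp (profile hp ha t) ^ p :=
  funext fun t => (hasDerivAt_velocity hp ha t).deriv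

lemma contDiff_profile : ContDiff ℝ 2 (profile hp ha) := by
  rw [show (2 : WithTop ℕ∞) = 1 + 1 from one_add_one_eq_two.symm, contDiff_succ_iff_deriv,
    deriv_profile, contDiff_one_iff_deriv, deriv_velocity]
  exact ⟨fun t => (hasDerivAt_profile hp ha t).differentiableAt, by simp,
    fun t => (hasDerivAt_velocity hp ha t).differentiableAt,
    (continuous_pp_profile_rpow hp ha (by linarith)).neg⟩

lemma profile_of_le {t : ℝ} (ht : -signedTime p a 0 ≤ |t|) :
    profile hp ha t =
      -Real.sqrt (2 / (p + 1)) * a ^ ((p + 1) / 2) * (|t| - -signedTime p a 0) := by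
  have hk : 0 < Real.sqrt ((p + 1) / 2) := Real.sqrt_pos.2 (by linarith)
  have hA : a ^ ((p + 1) / 2) = Real.sqrt (a ^ (p + 1)) := by
    rw [Real.sqrt_eq_rpow, ← Real.rpow_mul ha.le]
    ring_nf
  have hA0 : 0 < Real.sqrt (a ^ (p + 1)) := Real.sqrt_pos.2 (Real.rpow_pos_of_pos ha _)
  rw [hA, ← inv_div (p + 1) 2, Real.sqrt_inv, profile_eq_iff, signedTime_of_nonpos hp ha]
  · field_simp
    ring
  · have : 0 ≤ |t| - -signedTime p a 0 := sub_nonneg.2 ht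
    rw [neg_mul, neg_mul, neg_nonpos]
    positivity

end

lemma hasFDerivAt_comp_coord {u : ℝ → ℝ} {u' : ℝ} {x : R2} (h : HasDerivAt u u' (x 0)) :
    HasFDerivAt (fun y : R2 => u (y 0)) (u' • (EuclideanSpace.proj 0 : R2 →L[ℝ] ℝ)) x :=
  h.comp_hasFDerivAt x (EuclideanSpace.proj 0 : R2 →L[ℝ] ℝ).hasFDerivAt

lemma lap_comp_coord {u v w : ℝ → ℝ} (hu : ∀ t, HasDerivAt u (v t) t)
    (hv : ∀ t, HasDerivAt v (w t) t) (x : R2) : lap (fun y : R2 => u (y 0)) x = w (x 0) := by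
  have h1 : ∀ i : Fin 2, (fun y : R2 => fderiv ℝ (fun y : R2 => u (y 0)) y
      (EuclideanSpace.single i 1)) = fun y => v (y 0) * (EuclideanSpace.single i (1 : ℝ) : R2) 0 := by
    intro i
    funext y
    rw [(hasFDerivAt_comp_coord (hu (y 0))).fderiv]
    simp
  rw [lap, Fin.sum_univ_two, h1, h1]
  simp [(hasFDerivAt_comp_coord (hv (x 0))).fderiv]

lemma lintegral_comp_coord_eq_top {g : ℝ → ENNReal} (hg : Measurable g)
    (h : ∫⁻ t, g t ≠ 0) : ∫⁻ x : R2, g (x 0) = ⊤ := by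
  have h1 : ∫⁻ x : R2, g (x 0) = ∫⁻ z : Fin 2 → ℝ, g (z 0) :=
    (PiLp.volume_preserving_ofLp (Fin 2)).lintegral_comp (f := fun z : Fin 2 → ℝ => g (z 0))
      (hg.comp (measurable_pi_apply 0))
  have h2 : ∫⁻ z : Fin 2 → ℝ, g (z 0) = ∫⁻ z : ℝ × ℝ, g z.1 :=
    (volume_preserving_finTwoArrow ℝ).lintegral_comp (f := fun z : ℝ × ℝ => g z.1)
      (hg.comp measurable_fst)
  rw [h1, h2, Measure.volume_eq_prod, lintegral_prod (fun z : ℝ × ℝ => g z.1) (hg.comp measurable_fst).aemeasurable]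
  simp only [lintegral_const, Real.volume_univ]
  rw [lintegral_mul_const _ hg, ENNReal.mul_top h]

lemma lintegral_ofReal_comp_coord_eq_top {g : ℝ → ℝ} (hg : Continuous g) {t : ℝ} (ht : 0 < g t) :
    ∫⁻ x : R2, ENNReal.ofReal (g (x 0)) = ⊤ := by
  have hc : Continuous fun t => ENNReal.ofReal (g t) := ENNReal.continuous_ofReal.comp hg
  refine lintegral_comp_coord_eq_top hc.measurable fun h => ?_
  rw [lintegral_eq_zero_iff hc.measurable] at h
  have h0 := congrFun ((hc.ae_eq_iff_eq volume continuous_const).1 h) t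
  exact ht.not_ge (ENNReal.ofReal_eq_zero.1 h0)

lemma not_isBounded_coord_preimage {s : Set ℝ} (hs : s.Nonempty) :
    ¬ Bornology.IsBounded {x : R2 | x 0 ∈ s} := by
  obtain ⟨t, ht⟩ := hs
  intro h
  obtain ⟨C, hC⟩ := h.exists_norm_le
  have h1 := hC !₂[t, |C| + 1] (by simpa using ht)
  have h2 := (PiLp.norm_apply_le (!₂[t, |C| + 1] : R2) 1).trans h1
  simp only [Matrix.cons_val_one, Real.norm_eq_abs,
    Matrix.cons_val_fin_one] at h2
  linarith [le_abs_self C, le_abs_self (|C| + 1)]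

/-- one-dimensional infinite-mass solutions.  For every `a > 0`
there is an even `C²` function `u` with `u(0) = a`, `u′(0) = 0` solving
`−u″ = [u]₊^p` on `ℝ`, positive exactly on `(−t₀,t₀)` with
`t₀ = √((p+1)/2)·∫₀^a ds/√(a^{p+1}−s^{p+1})` finite, linear for `|t| ≥ t₀`;
the planar function `w^{(1D)}(x) = u(x¹)` is a classical solution of
`−Δw = [w]₊^p` in `ℝ²` with infinite `(p+k)`-masses, `k = −1,0,1`, and unbounded
plasma region `{w > 0}`. -/
theorem stmt10
    (p : ℝ) (hp : 1 < p)
    (a : ℝ) (ha : 0 < a) :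
    ∃ (u : ℝ → ℝ) (t₀ : ℝ),
      ContDiff ℝ 2 u ∧
      u 0 = a ∧ deriv u 0 = 0 ∧ (∀ t : ℝ, u (-t) = u t) ∧
      (∀ t : ℝ, -(deriv (deriv u) t) = pp (u t) ^ p) ∧
      IntervalIntegrable (fun s => 1 / Real.sqrt (a ^ (p + 1) - s ^ (p + 1))) volume 0 a ∧
      t₀ = Real.sqrt ((p + 1) / 2) *
        ∫ s in (0:ℝ)..a, 1 / Real.sqrt (a ^ (p + 1) - s ^ (p + 1)) ∧
      (∀ t : ℝ, 0 < u t ↔ |t| < t₀) ∧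
      (∀ t : ℝ, t₀ ≤ |t| → u t = -Real.sqrt (2 / (p + 1)) * a ^ ((p + 1) / 2) * (|t| - t₀)) ∧
      (∀ x : R2, -lap (fun y : R2 => u (y 0)) x = pp (u (x 0)) ^ p) ∧
      (∫⁻ x : R2, ENNReal.ofReal (pp (u (x 0)) ^ (p - 1)) = ⊤) ∧
      (∫⁻ x : R2, ENNReal.ofReal (pp (u (x 0)) ^ p) = ⊤) ∧
      (∫⁻ x : R2, ENNReal.ofReal (pp (u (x 0)) ^ (p + 1)) = ⊤) ∧
      ¬ Bornology.IsBounded {x : R2 | 0 < u (x 0)} := by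
  have hmass : ∀ q : ℝ, 0 < q → ∫⁻ x : R2, ENNReal.ofReal (pp (profile hp ha (x 0)) ^ q) = ⊤ :=
    fun q hq => lintegral_ofReal_comp_coord_eq_top (continuous_pp_profile_rpow hp ha hq) (t := 0)
      (by rw [profile_zero, pp_of_nonneg ha.le]; exact Real.rpow_pos_of_pos ha q)
  refine ⟨profile hp ha, -signedTime p a 0, contDiff_profile hp ha, profile_zero hp ha, ?_, ?_, ?_,
    ?_, ?_, ?_, fun t => profile_of_le hp ha, ?_, hmass _ (by linarith), hmass _ (by linarith),
    hmass _ (by linarith), ?_⟩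
  · rw [deriv_profile, velocity_zero]
  · intro t
    rw [profile, profile, abs_neg]
  · intro t
    rw [deriv_profile, deriv_velocity, neg_neg]
  · refine (intervalIntegrable_inv_sqrt_energyGap hp ha).congr_uIoo fun s hs => ?_
    rw [uIoo_of_le ha.le] at hs
    simp only [energyGap, pp_of_nonneg hs.1.le]
  · rw [signedTime_zero ha, neg_neg]
  · intro t
    rw [lt_profile_iff, lt_neg]
  · intro x
    rw [lap_comp_coord (hasDerivAt_profile hp ha) (hasDerivAt_velocity hp ha), neg_neg]
  · exact not_isBounded_coord_preimage (s := {t | 0 < profile hp ha t})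
      ⟨0, by rw [mem_ofPred_eq, profile_zero]; exact ha⟩
end
end
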